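/- Let I ⊂ K[x,y] be a monomial ideal with minimal generators u_i = x^{a_i}y^{b_i}, i = 0,...,m, ordered with a_0 > ... > a_m and b_0 < ... < b_m. Then I = x^{a_m}y^{b_0}·J is componentwise polymatroidal if and only if J is a yx-tight ideal. -/

import Mathlib

/-- A monomial in `K[x_1,...,x_n]` is identified with its exponent vector. -/
abbrev Mon (n : ℕ) := Fin n → ℕ

/-- Total degree of a monomial. -/
def degree {n : ℕ} (u : Mon n) : ℕ := ∑ i, u i

/-- A monomial ideal is identified with the set of exponent vectors of the monomials it
contains; this set is closed under multiplication by monomials. -/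
def IsMonomialIdeal {n : ℕ} (I : Set (Mon n)) : Prop :=
  ∀ u ∈ I, ∀ w : Mon n, u + w ∈ I

/-- The minimal monomial generating set `G(I)` of a monomial ideal: monomials of `I`
minimal with respect to divisibility (pointwise `≤` of exponent vectors). -/
def minGens {n : ℕ} (I : Set (Mon n)) : Set (Mon n) :=
  {u | u ∈ I ∧ ∀ v ∈ I, v ≤ u → v = u}

/-- `exch v i j` is the exponent vector of `x_j * (v / x_i)` (for `i ≠ j`). -/
def exch {n : ℕ} (v : Mon n) (i j : Fin n) : Mon n :=
  fun k => if k = i then v k - 1 else if k = j then v k + 1 else v k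

/-- `component I d` is the ideal `I_⟨d⟩` generated by the degree-`d` monomials of `I`. -/
def component {n : ℕ} (I : Set (Mon n)) (d : ℕ) : Set (Mon n) :=
  {w | ∃ u ∈ I, degree u = d ∧ u ≤ w}

/-- `I` is generated in a single degree. -/
def GeneratedInSingleDegree {n : ℕ} (I : Set (Mon n)) : Prop :=
  ∃ d, ∀ u ∈ minGens I, degree u = d

/-- A polymatroidal ideal: generated in a single degree and its generators satisfy the
exchange property. -/
def IsPolymatroidal {n : ℕ} (I : Set (Mon n)) : Prop :=
  GeneratedInSingleDegree I ∧
  ∀ u ∈ minGens I, ∀ v ∈ minGens I, ∀ i : Fin n, v i < u i →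
    ∃ j : Fin n, u j < v j ∧ exch u i j ∈ I

/-- Componentwise polymatroidal: each graded component ideal `I_⟨d⟩` is polymatroidal. -/
def ComponentwisePolymatroidal {n : ℕ} (I : Set (Mon n)) : Prop :=
  ∀ d : ℕ, IsPolymatroidal (component I d)

/-- Non-pure dual exchange property: for `u, v ∈ G(I)` with `deg u ≤ deg v` and
`deg_{x_i} v < deg_{x_i} u` there is `j` with `deg_{x_j} v > deg_{x_j} u` and
`x_i * (v / x_j) ∈ I`. -/
def NonPureDualExchange {n : ℕ} (I : Set (Mon n)) : Prop :=
  ∀ u ∈ minGens I, ∀ v ∈ minGens I, degree u ≤ degree v →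
    ∀ i : Fin n, v i < u i → ∃ j : Fin n, u j < v j ∧ exch v j i ∈ I

/-- Non-pure exchange property: for `u, v ∈ G(I)` with `deg u ≤ deg v` and
`deg_{x_i} v > deg_{x_i} u` there is `j` with `deg_{x_j} v < deg_{x_j} u` and
`x_j * (v / x_i) ∈ I`. -/
def NonPureExchange {n : ℕ} (I : Set (Mon n)) : Prop :=
  ∀ u ∈ minGens I, ∀ v ∈ minGens I, degree u ≤ degree v →
    ∀ i : Fin n, u i < v i → ∃ j : Fin n, v j < u j ∧ exch v i j ∈ I

/-- The monomial ideal generated by a set `G` of monomials. -/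
def genBy {n : ℕ} (G : Set (Mon n)) : Set (Mon n) := {w | ∃ u ∈ G, u ≤ w}

/-- The product of two monomial ideals (as sets of monomials). -/
def mulIdeal {n : ℕ} (I J : Set (Mon n)) : Set (Mon n) :=
  {w | ∃ u ∈ I, ∃ v ∈ J, w = u + v}

/-- The product of a monomial ideal with the monomial `u`. -/
def mulMon {n : ℕ} (u : Mon n) (I : Set (Mon n)) : Set (Mon n) :=
  (fun v => u + v) '' I

/-- Strong exchange property: for all generators `u, v` and all `i, j` with
`deg_{x_i} u > deg_{x_i} v` and `deg_{x_j} u < deg_{x_j} v`, `x_j * (u / x_i) ∈ I`. -/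
def StrongExchange {n : ℕ} (I : Set (Mon n)) : Prop :=
  ∀ u ∈ minGens I, ∀ v ∈ minGens I, ∀ i j : Fin n,
    v i < u i → u j < v j → exch u i j ∈ I

/-- The Veronese type ideal `I_{(d; a_1,...,a_n)}`: generated by all monomials of
degree `d` with `deg_{x_i} ≤ a i` for all `i`. -/
def veronese (n d : ℕ) (a : Fin n → ℕ) : Set (Mon n) :=
  {w | ∃ u : Mon n, degree u = d ∧ (∀ i, u i ≤ a i) ∧ u ≤ w}

/-- A list of monomials is an admissible order if each colon ideal
`(u_1,...,u_{i-1}) : u_i` is generated by a subset `S` of the variables. -/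
def AdmissibleOrder {n : ℕ} (L : List (Mon n)) : Prop :=
  ∀ i : Fin L.length, ∃ S : Set (Fin n),
    ∀ w : Mon n, (w + L.get i ∈ genBy {u | u ∈ L.take i.1}) ↔ ∃ k ∈ S, 1 ≤ w k

/-- `I` has linear quotients: some ordering of `G(I)` is admissible. -/
def HasLinearQuotients {n : ℕ} (I : Set (Mon n)) : Prop :=
  ∃ L : List (Mon n), L.Nodup ∧ (∀ u, u ∈ L ↔ u ∈ minGens I) ∧ AdmissibleOrder L

/-- `I` can be extended by linear quotients to `J`: `G(I) ⊆ G(J)` and the elements of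
`G(J) \ G(I)` can be ordered `v_1,...,v_m` such that each colon ideal
`(G(I), v_1,...,v_i) : v_{i+1}` is generated by a subset of the variables. -/
def ExtendsByLinearQuotients {n : ℕ} (I J : Set (Mon n)) : Prop :=
  I ⊆ J ∧ minGens I ⊆ minGens J ∧
  ∃ L : List (Mon n), L.Nodup ∧ (∀ u, u ∈ L ↔ u ∈ minGens J ∧ u ∉ minGens I) ∧
    ∀ i : Fin L.length, ∃ S : Set (Fin n),
      ∀ w : Mon n,
        (w + L.get i ∈ genBy (minGens I ∪ {u | u ∈ L.take i.1})) ↔ ∃ k ∈ S, 1 ≤ w k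

/-- The minimal generators of `I ⊆ K[x,y]` are `u_i = x^{a i} y^{b i}`, `i = 0,...,m`,
with `a` strictly decreasing, `b` strictly increasing, `a m = 0` and `b 0 = 0`
(so `I` is `(x,y)`-primary). -/
def yxTightGens (m : ℕ) (a b : ℕ → ℕ) (I : Set (Mon 2)) : Prop :=
  (∀ i k : ℕ, i ≤ m → k ≤ m → i < k → a k < a i ∧ b i < b k) ∧
  a m = 0 ∧ b 0 = 0 ∧
  minGens I = {u | ∃ i ≤ m, u = ![a i, b i]}

/-- `I` is `x`-tight in `[0, r]`: the `x`-exponents of the generators are exactly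
`r, r-1, ..., 1, 0` (i.e. `a (r - i) = i`). -/
def xTight (I : Set (Mon 2)) (r : ℕ) : Prop :=
  ∃ b : ℕ → ℕ, yxTightGens r (fun i => r - i) b I

/-- `I` is `y`-tight in `[0, s]`: the `y`-exponents of the generators are exactly
`0, 1, ..., s`. -/
def yTight (I : Set (Mon 2)) (s : ℕ) : Prop :=
  ∃ a : ℕ → ℕ, yxTightGens s a (fun i => i) I

/-- `I` is `yx`-tight: there is `0 ≤ j ≤ m` with `b i = i` for `i = 0,...,j` and
`a (m - i) = i` for `i = 0,...,m-j`. -/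
def yxTight (I : Set (Mon 2)) : Prop :=
  ∃ (m : ℕ) (a b : ℕ → ℕ), yxTightGens m a b I ∧
    ∃ j ≤ m, (∀ i ≤ j, b i = i) ∧ ∀ i ≤ m - j, a (m - i) = i

/-- Powers of a monomial ideal. -/
def powIdeal {n : ℕ} (I : Set (Mon n)) : ℕ → Set (Mon n)
  | 0 => Set.univ
  | k + 1 => mulIdeal (powIdeal I k) I

/-- Exchange of neighbouring monomials of equal degree: the monomials of a given degree in `I`
have `x`-exponents forming an interval. -/
def StepExchange (I : Set (Mon 2)) : Prop :=
  ∀ p q r s : ℕ, ![p, q + 1] ∈ I → ![r + 1, s] ∈ I → p + q = r + s → p ≤ r →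
    ![p + 1, q] ∈ I ∧ ![r, s + 1] ∈ I

theorem IsMonomialIdeal.mem_of_le {n : ℕ} {I : Set (Mon n)} (hI : IsMonomialIdeal I)
    {u w : Mon n} (hu : u ∈ I) (h : u ≤ w) : w ∈ I := by
  simpa [add_tsub_cancel_of_le h] using hI u hu (w - u)

theorem exists_minGens_le {n : ℕ} {I : Set (Mon n)} {w : Mon n} (hw : w ∈ I) :
    ∃ u ∈ minGens I, u ≤ w := by
  obtain ⟨u, huw, hu⟩ := exists_minimal_le_of_wellFoundedLT (· ∈ I) w hw
  exact ⟨u, ⟨hu.prop, fun v hv hvu => le_antisymm hvu (hu.le_of_le hv hvu)⟩, huw⟩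

theorem mem_iff_of_minGens_eq {I : Set (Mon 2)} (hI : IsMonomialIdeal I) {m : ℕ} {a b : ℕ → ℕ}
    (hgens : minGens I = {u | ∃ i ≤ m, u = ![a i, b i]}) (p q : ℕ) :
    ![p, q] ∈ I ↔ ∃ i ≤ m, a i ≤ p ∧ b i ≤ q := by
  constructor
  · intro h
    obtain ⟨u, hu, hle⟩ := exists_minGens_le h
    rw [hgens] at hu
    obtain ⟨i, hi, rfl⟩ := hu
    exact ⟨i, hi, by simpa using hle 0, by simpa using hle 1⟩
  · rintro ⟨i, hi, ha, hb⟩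
    have hg : ![a i, b i] ∈ minGens I := by
      rw [hgens]
      exact ⟨i, hi, rfl⟩
    refine hI.mem_of_le hg.1 fun k => ?_
    fin_cases k
    · simpa using ha
    · simpa using hb

theorem eq_of_le_of_degree_eq {n : ℕ} {u v : Mon n} (h : u ≤ v) (hd : degree u = degree v) :
    u = v := by
  funext i
  exact (Finset.sum_eq_sum_iff_of_le fun i _ => h i).1 hd i (Finset.mem_univ i)

theorem mem_minGens_component {n : ℕ} {I : Set (Mon n)} {d : ℕ} {u : Mon n} :
    u ∈ minGens (component I d) ↔ u ∈ I ∧ degree u = d := by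
  constructor
  · rintro ⟨⟨v, hv, hd, hle⟩, hmin⟩
    obtain rfl := hmin v ⟨v, hv, hd, le_rfl⟩ hle
    exact ⟨hv, hd⟩
  · rintro ⟨hu, hd⟩
    refine ⟨⟨u, hu, hd, le_rfl⟩, ?_⟩
    rintro v ⟨w, -, hwd, hwv⟩ hvu
    have hwu := eq_of_le_of_degree_eq (hwv.trans hvu) (hwd.trans hd.symm)
    exact le_antisymm hvu (hwu ▸ hwv)

theorem exch_one_zero (p q : ℕ) : exch ![p, q] 1 0 = ![p + 1, q - 1] := by
  funext k
  fin_cases k <;> simp [exch]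

theorem exch_zero_one (p q : ℕ) : exch ![p, q] 0 1 = ![p - 1, q + 1] := by
  funext k
  fin_cases k <;> simp [exch]

theorem degree_pair (p q : ℕ) : degree ![p, q] = p + q := by
  simp [degree]

theorem component_subset {n : ℕ} {I : Set (Mon n)} (hI : IsMonomialIdeal I) (d : ℕ) :
    component I d ⊆ I := by
  rintro w ⟨u, hu, -, hle⟩
  exact hI.mem_of_le hu hle

theorem componentwisePolymatroidal_iff_stepExchange {I : Set (Mon 2)} (hI : IsMonomialIdeal I) :
    ComponentwisePolymatroidal I ↔ StepExchange I := by
  constructor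
  · intro h p q r s hu hv hd hpr
    obtain ⟨-, hex⟩ := h (p + (q + 1))
    have hu' := mem_minGens_component.2 ⟨hu, degree_pair p (q + 1)⟩
    have hv' := mem_minGens_component.2
      ⟨hv, (degree_pair (r + 1) s).trans (by omega : r + 1 + s = p + (q + 1))⟩
    constructor
    · obtain ⟨j, hj, hmem⟩ := hex _ hu' _ hv' 1 (by simp; omega)
      fin_cases j
      · simpa [exch_one_zero] using component_subset hI _ hmem
      · simp at hj; omega
    · obtain ⟨j, hj, hmem⟩ := hex _ hv' _ hu' 0 (by simp; omega)
      fin_cases j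
      · simp at hj; omega
      · simpa [exch_zero_one] using component_subset hI _ hmem
  · intro h d
    refine ⟨⟨d, fun u hu => (mem_minGens_component.1 hu).2⟩, fun u hu v hv i hi => ?_⟩
    rw [mem_minGens_component] at hu hv
    obtain ⟨p, q, rfl⟩ : ∃ p q, u = ![p, q] := ⟨u 0, u 1, by funext k; fin_cases k <;> rfl⟩
    obtain ⟨r, s, rfl⟩ : ∃ r s, v = ![r, s] := ⟨v 0, v 1, by funext k; fin_cases k <;> rfl⟩
    rw [degree_pair] at hu hv
    obtain ⟨hu, rfl⟩ := hu
    obtain ⟨hv, hd⟩ := hv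
    fin_cases i
    · have hi : r < p := by simpa using hi
      obtain ⟨p, rfl⟩ : ∃ p', p = p' + 1 := ⟨p - 1, by omega⟩
      obtain ⟨s, rfl⟩ : ∃ s', s = s' + 1 := ⟨s - 1, by omega⟩
      refine ⟨1, by simp; omega, ![p, q + 1], (h r s p q hv hu (by omega) (by omega)).2, ?_, ?_⟩
      · rw [degree_pair]; omega
      · exact (exch_zero_one (p + 1) q).ge
    · have hi : s < q := by simpa using hi
      obtain ⟨q, rfl⟩ : ∃ q', q = q' + 1 := ⟨q - 1, by omega⟩
      obtain ⟨r, rfl⟩ : ∃ r', r = r' + 1 := ⟨r - 1, by omega⟩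
      refine ⟨0, by simp; omega, ![p + 1, q], (h p q r s hu hv (by omega) (by omega)).1, ?_, ?_⟩
      · rw [degree_pair]; omega
      · exact (exch_one_zero p (q + 1)).ge

theorem add_sub_le_of_strict {m : ℕ} {a b : ℕ → ℕ}
    (horder : ∀ i k : ℕ, i ≤ m → k ≤ m → i < k → a k < a i ∧ b i < b k)
    {i k : ℕ} (hik : i ≤ k) (hk : k ≤ m) : a k + (k - i) ≤ a i ∧ b i + (k - i) ≤ b k := by
  induction k, hik using Nat.le_induction with
  | base => simp
  | succ k hik ih =>
    have := ih (by omega)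
    have := horder k (k + 1) (by omega) hk (by omega)
    omega

theorem stepExchange_of_yxTight {J : Set (Mon 2)} (hJ : IsMonomialIdeal J) (h : yxTight J) :
    StepExchange J := by
  obtain ⟨m, a, b, ⟨horder, ham, hb0, hgens⟩, j, hj, hbj, haj⟩ := h
  have haj' : ∀ i, j ≤ i → i ≤ m → a i = m - i := fun i hi him => by
    have := haj (m - i) (by omega)
    rwa [Nat.sub_sub_self him] at this
  have hmem := mem_iff_of_minGens_eq hJ hgens
  have key : ∀ i k, i ≤ m → k ≤ m → a i < a k ∨ b k < b i → k < i := by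
    intro i k hi hk hlt
    by_contra! hle
    have := add_sub_le_of_strict horder hle hk
    omega
  intro p q r s hu hv hd hpr
  obtain ⟨i, him, hai, hbi⟩ := (hmem _ _).1 hu
  obtain ⟨k, hkm, hak, hbk⟩ := (hmem _ _).1 hv
  rw [hmem, hmem]
  constructor
  · by_cases h1 : b i ≤ q
    · exact ⟨i, him, by omega, h1⟩
    by_cases h2 : a k ≤ p + 1
    · exact ⟨k, hkm, h2, by omega⟩
    have hki := key i k him hkm (by omega)
    have hb := add_sub_le_of_strict horder (by omega : i - 1 ≤ i) him
    have hka := add_sub_le_of_strict horder (by omega : k ≤ i - 1) (by omega)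
    refine ⟨i - 1, by omega, ?_, by omega⟩
    by_cases hij : i ≤ j
    · have := hbj i hij
      have := hbj k (by omega)
      omega
    · have := haj' i (by omega) him
      have := haj' (i - 1) (by omega) (by omega)
      omega
  · by_cases h1 : a k ≤ r
    · exact ⟨k, hkm, h1, by omega⟩
    by_cases h2 : b i ≤ s + 1
    · exact ⟨i, him, by omega, h2⟩
    have hki := key i k him hkm (by omega)
    have hb := add_sub_le_of_strict horder (by omega : k ≤ k + 1) (by omega)
    have hka := add_sub_le_of_strict horder (by omega : k + 1 ≤ i) (by omega)
    refine ⟨k + 1, by omega, by omega, ?_⟩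
    by_cases hkj : k < j
    · have := hbj k (by omega)
      have := hbj (k + 1) (by omega)
      omega
    · have := haj' i (by omega) him
      have := haj' k (by omega) (by omega)
      omega

theorem StepExchange.gap_eq_one {I : Set (Mon 2)} (hI : IsMonomialIdeal I) (h : StepExchange I)
    {m : ℕ} {a b : ℕ → ℕ}
    (horder : ∀ i k : ℕ, i ≤ m → k ≤ m → i < k → a k < a i ∧ b i < b k)
    (hgens : minGens I = {u | ∃ i ≤ m, u = ![a i, b i]})
    {k l : ℕ} (hkl : k ≤ l) (hl : l < m) : b (k + 1) = b k + 1 ∨ a l = a (l + 1) + 1 := by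
  have hmem := mem_iff_of_minGens_eq hI hgens
  by_contra! hne
  have hk1 := horder k (k + 1) (by omega) (by omega) (by omega)
  have hl1 := horder l (l + 1) (by omega) (by omega) (by omega)
  have hkl' := add_sub_le_of_strict horder hkl hl.le
  have hkl1 := add_sub_le_of_strict horder (by omega : k + 1 ≤ l + 1) (by omega)
  rcases le_total (a (l + 1) + b (l + 1)) (a k + b k) with hd | hd
  · have := (h (a (l + 1)) (a k + b k - a (l + 1) - 1) (a k - 1) (b k)
      ((hmem _ _).2 ⟨l + 1, by omega, by omega, by omega⟩)
      ((hmem _ _).2 ⟨k, by omega, by omega, by omega⟩) (by omega) (by omega)).2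
    obtain ⟨i, hi, hai, hbi⟩ := (hmem _ _).1 this
    rcases le_or_gt i k with hik | hik
    · have := add_sub_le_of_strict horder hik (by omega)
      omega
    · have := add_sub_le_of_strict horder (by omega : k + 1 ≤ i) hi
      omega
  · have := (h (a (l + 1)) (b (l + 1) - 1) (a (l + 1) + b (l + 1) - b k - 1) (b k)
      ((hmem _ _).2 ⟨l + 1, by omega, by omega, by omega⟩)
      ((hmem _ _).2 ⟨k, by omega, by omega, by omega⟩) (by omega) (by omega)).1
    obtain ⟨i, hi, hai, hbi⟩ := (hmem _ _).1 this
    rcases le_or_gt i l with hil | hil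
    · have := add_sub_le_of_strict horder hil (by omega)
      omega
    · have := add_sub_le_of_strict horder (by omega : l + 1 ≤ i) hi
      omega

theorem mem_mulMon {n : ℕ} {c w : Mon n} {J : Set (Mon n)} :
    w ∈ mulMon c J ↔ c ≤ w ∧ w - c ∈ J := by
  constructor
  · rintro ⟨v, hv, rfl⟩
    simpa using hv
  · rintro ⟨hle, hv⟩
    exact ⟨w - c, hv, add_tsub_cancel_of_le hle⟩

theorem add_mem_minGens_mulMon {n : ℕ} {c u : Mon n} {J : Set (Mon n)} :
    c + u ∈ minGens (mulMon c J) ↔ u ∈ minGens J := by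
  constructor
  · rintro ⟨h, hmin⟩
    refine ⟨by simpa using (mem_mulMon.1 h).2, fun v hv hvu => ?_⟩
    exact add_left_cancel (hmin (c + v) ⟨v, hv, rfl⟩ (by gcongr))
  · rintro ⟨h, hmin⟩
    refine ⟨⟨u, h, rfl⟩, ?_⟩
    rintro - ⟨v, hv, rfl⟩ hle
    exact congrArg (c + ·) (hmin v hv (le_of_add_le_add_left hle))

theorem pair_mem_mulMon {c₀ c₁ p q : ℕ} {J : Set (Mon 2)} :
    ![p, q] ∈ mulMon ![c₀, c₁] J ↔ c₀ ≤ p ∧ c₁ ≤ q ∧ ![p - c₀, q - c₁] ∈ J := by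
  have hsub : ![p, q] - ![c₀, c₁] = ![p - c₀, q - c₁] := by
    funext k
    fin_cases k <;> rfl
  rw [mem_mulMon, hsub, Pi.le_def, Fin.forall_fin_two, and_assoc]
  rfl

theorem StepExchange.mulMon {J : Set (Mon 2)} (h : StepExchange J) (c₀ c₁ : ℕ) :
    StepExchange (mulMon ![c₀, c₁] J) := by
  intro p q r s hu hv hd hpr
  rw [pair_mem_mulMon] at hu hv ⊢
  rw [pair_mem_mulMon]
  obtain ⟨hp, -, hu⟩ := hu
  obtain ⟨-, hs, hv⟩ := hv
  rw [Nat.sub_add_comm (by omega)] at hu hv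
  obtain ⟨h₁, h₂⟩ := h _ _ _ _ hu hv (by omega) (by omega)
  rw [← Nat.sub_add_comm (by omega)] at h₁ h₂
  exact ⟨⟨by omega, by omega, h₁⟩, by omega, by omega, h₂⟩

theorem yxTight_of_gap_eq_one {J : Set (Mon 2)} {m : ℕ} {a b : ℕ → ℕ}
    (hgens : yxTightGens m a b J)
    (hgap : ∀ k l, k ≤ l → l < m → b (k + 1) = b k + 1 ∨ a l = a (l + 1) + 1) :
    yxTight J := by
  refine ⟨m, a, b, hgens, ?_⟩
  obtain ⟨-, ham, hb0, -⟩ := hgens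
  have hex : ∃ j, j = m ∨ b (j + 1) ≠ b j + 1 := ⟨m, Or.inl rfl⟩
  have hjm : Nat.find hex ≤ m := Nat.find_min' hex (Or.inl rfl)
  refine ⟨Nat.find hex, hjm, fun i => ?_, fun i => ?_⟩
  · induction i with
    | zero => simp [hb0]
    | succ i ih =>
      intro hi
      have := Nat.find_min hex (m := i) (by omega)
      push Not at this
      rw [this.2, ih (by omega)]
  · induction i with
    | zero => simp [ham]
    | succ i ih =>
      intro hi
      have hstep := hgap (Nat.find hex) (m - (i + 1)) (by omega) (by omega)
      rw [show m - (i + 1) + 1 = m - i by omega, ih (by omega)] at hstep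
      have := Nat.find_spec hex
      omega

/-- `I = x^{a m} y^{b 0} · J` is componentwise polymatroidal iff `J` is a
`yx`-tight ideal. -/
theorem stmt_8 (I J : Set (Mon 2)) (hI : IsMonomialIdeal I) (hJ : IsMonomialIdeal J)
    (m : ℕ) (a b : ℕ → ℕ)
    (horder : ∀ i k : ℕ, i ≤ m → k ≤ m → i < k → a k < a i ∧ b i < b k)
    (hgens : minGens I = {u | ∃ i ≤ m, u = ![a i, b i]})
    (hIJ : I = mulMon ![a m, b 0] J) :
    ComponentwisePolymatroidal I ↔ yxTight J := by
  rw [componentwisePolymatroidal_iff_stepExchange hI]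
  constructor
  · intro h
    have hlast : ∀ i ≤ m, a m ≤ a i ∧ b 0 ≤ b i := fun i hi =>
      ⟨by have := add_sub_le_of_strict horder hi le_rfl; omega,
        by have := add_sub_le_of_strict horder (Nat.zero_le i) hi; omega⟩
    refine yxTight_of_gap_eq_one (m := m) (a := fun i => a i - a m) (b := fun i => b i - b 0)
      ⟨fun i k hi hk hik => ?_, by simp, by simp, ?_⟩ fun k l hkl hl => ?_
    · have := horder i k hi hk hik
      have := hlast i hi
      have := hlast k hk
      dsimp only
      omega
    · ext u
      rw [← add_mem_minGens_mulMon (c := ![a m, b 0]), ← hIJ, hgens]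
      refine exists_congr fun i => and_congr_right fun hi => ?_
      have := hlast i hi
      simp only [funext_iff, Fin.forall_fin_two, Pi.add_apply, Matrix.cons_val_zero,
        Matrix.cons_val_one]
      omega
    · have := h.gap_eq_one hI horder hgens hkl hl
      have := hlast k (by omega)
      have := hlast (k + 1) (by omega)
      have := hlast l (by omega)
      have := hlast (l + 1) (by omega)
      omega
  · intro h
    rw [hIJ]
    exact (stepExchange_of_yxTight hJ h).mulMon _ _
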